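/- Let T be a minimal 3-interval exchange transformation with permutation (321) exchanging intervals of lengths λ_1, λ_2, λ_3. Then T satisfies the infinite distinct orbit condition if and only if for every pair of integers n, m one has n(λ_1 − λ_3) ≠ λ_1 + m(1 − λ_3). -/

import Mathlib

open Set

namespace IETRoots

noncomputable section

/-- The unit interval `[0,1)`, the domain of our interval exchange transformations. -/
def unitI : Set ℝ := Set.Ico 0 1

/-- `T : ℝ → ℝ` is (the extension by the identity of) an interval exchange
transformation: it fixes the complement of `[0,1)`, maps `[0,1)` bijectively onto
itself, and there is a finite partition of `[0,1)` into half-open intervals on each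
of which `T` is a translation.  The group `𝔾` of IETs is the set of such maps under
composition. -/
def IsIET (T : ℝ → ℝ) : Prop :=
  Set.BijOn T unitI unitI ∧ (∀ x, x ∉ unitI → T x = x) ∧
  ∃ (k : ℕ) (β : Fin (k + 1) → ℝ), StrictMono β ∧ β 0 = 0 ∧ β (Fin.last k) = 1 ∧
    ∀ i : Fin k, ∃ c : ℝ, ∀ x ∈ Set.Ico (β i.castSucc) (β i.succ), T x = x + c

/-- The `ℤ`-orbit `{T^n x : n ∈ ℤ}` of `x` under the bijection `T`. -/
def orbitZ (T : ℝ → ℝ) (x : ℝ) : Set ℝ := {y | ∃ n : ℕ, T^[n] x = y ∨ T^[n] y = x}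

/-- `T` is minimal: every orbit is dense in `[0,1)`. -/
def IsMinimal (T : ℝ → ℝ) : Prop := ∀ x ∈ unitI, unitI ⊆ closure (orbitZ T x)

/-- `T` is of rotation type: `T x = x + α (mod 1)` on `[0,1)`. -/
def IsRotationType (T : ℝ → ℝ) : Prop := ∃ α : ℝ, ∀ x ∈ unitI, T x = Int.fract (x + α)

/-- `T` has an `n`-th root in the group `𝔾` of IETs for some `n ≥ 2`. -/
def HasNontrivialRoot (T : ℝ → ℝ) : Prop :=
  ∃ (S : ℝ → ℝ) (n : ℕ), IsIET S ∧ 2 ≤ n ∧ S^[n] = T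

/-- The set `D(T)` of points of `[0,1)` at which `T` is discontinuous
(as a map of `[0,1)`). -/
def DiscSet (T : ℝ → ℝ) : Set ℝ := {x | x ∈ unitI ∧ ¬ ContinuousWithinAt T unitI x}

/-- `β_j = λ_1 + ⋯ + λ_j` (`0`-indexed: the sum of the first `j` lengths). -/
def betaPt {m : ℕ} (lam : Fin m → ℝ) (j : ℕ) : ℝ :=
  ∑ i ∈ Finset.univ.filter (fun i : Fin m => (i : ℕ) < j), lam i

/-- The interval exchange transformation `T_{(π,λ)}` determined by a permutation
`π ∈ S_m` and a length vector `λ`: on `I_j = [β_{j-1}, β_j)` it is given by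
`x ↦ x - ∑_{i<j} λ_i + ∑_{π(i)<π(j)} λ_i`; outside `[0,1)` it is the identity. -/
noncomputable def ietMap {m : ℕ} (π : Equiv.Perm (Fin m)) (lam : Fin m → ℝ) : ℝ → ℝ :=
  fun x =>
    if h : ∃ j : Fin m, x ∈ Set.Ico (betaPt lam (j : ℕ)) (betaPt lam (j : ℕ) + lam j) then
      x - betaPt lam (h.choose : ℕ) +
        ∑ i ∈ Finset.univ.filter (fun i : Fin m => π i < π h.choose), lam i
    else x

/-- A permutation `π ∈ S_m` is separating if `π(i+1) ≠ π(i) + 1` for `1 ≤ i ≤ m-1`. -/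
def Separating {m : ℕ} (π : Equiv.Perm (Fin m)) : Prop :=
  ∀ i j : Fin m, (j : ℕ) = (i : ℕ) + 1 → (π j : ℕ) ≠ (π i : ℕ) + 1

/-- A permutation `π ∈ S_m` is irreducible if `π({1,…,k}) ≠ {1,…,k}` for all `k < m`. -/
def IrreduciblePerm {m : ℕ} (π : Equiv.Perm (Fin m)) : Prop :=
  ∀ k : ℕ, 1 ≤ k → k < m → ∃ i : Fin m, (i : ℕ) < k ∧ k ≤ (π i : ℕ)

/-- The endpoints `0 = γ_0 < γ_1 < ⋯ < γ_{m-1} < γ_m = 1`, namely the discontinuities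
of `T` together with `0` and `1`. -/
def endpointsOf (T : ℝ → ℝ) : Set ℝ := insert 0 (insert 1 (DiscSet T))

/-- The set of lengths `l_j = γ_j - γ_{j-1}` of the intervals of continuity of `T`,
i.e. the gaps between consecutive endpoints. -/
def gapLengths (T : ℝ → ℝ) : Set ℝ :=
  {l | ∃ a ∈ endpointsOf T, ∃ b ∈ endpointsOf T,
        a < b ∧ (∀ c ∈ endpointsOf T, ¬(a < c ∧ c < b)) ∧ l = b - a}

/-- The rank of `T`: the dimension of the `ℚ`-vector space spanned by the lengths
`l_1, …, l_m`. -/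
noncomputable def ietRank (T : ℝ → ℝ) : ℕ :=
  Module.finrank ℚ (Submodule.span ℚ (gapLengths T))

/-- Keane's infinite distinct orbit condition for an `m`-IET `T = T_{(π,λ)}`:
the orbits of `β_1, …, β_{m-1}` are infinite and pairwise disjoint. -/
def SatisfiesIDOC {m : ℕ} (lam : Fin m → ℝ) (T : ℝ → ℝ) : Prop :=
  (∀ j : ℕ, 1 ≤ j → j ≤ m - 1 → (orbitZ T (betaPt lam j)).Infinite) ∧
  ∀ j j' : ℕ, 1 ≤ j → j ≤ m - 1 → 1 ≤ j' → j' ≤ m - 1 → j ≠ j' →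
    orbitZ T (betaPt lam j) ∩ orbitZ T (betaPt lam j') = ∅

/-- A rotation: a `2`-IET with permutation `(21)`, i.e. `x ↦ x + α (mod 1)`
with `α ∈ (0,1)`. -/
def IsRotation (S : ℝ → ℝ) : Prop :=
  (∀ x, x ∉ unitI → S x = x) ∧ ∃ α ∈ Set.Ioo (0 : ℝ) 1, ∀ x ∈ unitI, S x = Int.fract (x + α)

/-- Conjugacy in the group `𝔾` of IETs. -/
def IsConjugate (T T' : ℝ → ℝ) : Prop := ∃ g : ℝ → ℝ, IsIET g ∧ g ∘ T = T' ∘ g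

/-- `T` is a tower of type `(n_1, …, n_k)` over the `k`-IET `S`:  there is a partition
`0 = t_0 < t_1 < ⋯ < t_k = 1` into intervals `I_i` on which `S` is a translation, a
scaling factor `c > 0`, and for each `i` a family of `n_i` pairwise disjoint "levels"
(scaled copies of `I_i`) which together partition `[0,1)`, such that `T` translates each
level of the `i`-th column onto the next one, and maps the top level back to the bottom
levels according to `S` (all after rescaling by `c`). -/
def IsTowerOver {k : ℕ} (T : ℝ → ℝ) (n : Fin k → ℕ) (S : ℝ → ℝ) : Prop :=
  IsIET T ∧ IsIET S ∧ (∀ i, 0 < n i) ∧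
  ∃ (t : Fin (k + 1) → ℝ) (c : ℝ) (a : Fin k → ℕ → ℝ),
    StrictMono t ∧ t 0 = 0 ∧ t (Fin.last k) = 1 ∧ 0 < c ∧
    (∀ i : Fin k, ∃ d : ℝ, ∀ x ∈ Set.Ico (t i.castSucc) (t i.succ), S x = x + d) ∧
    (∀ i : Fin k, ∀ j : ℕ, j < n i →
      Set.Ico (a i j) (a i j + c * (t i.succ - t i.castSucc)) ⊆ unitI) ∧
    (∀ i i' : Fin k, ∀ j j' : ℕ, j < n i → j' < n i' → (i, j) ≠ (i', j') →
      Disjoint (Set.Ico (a i j) (a i j + c * (t i.succ - t i.castSucc)))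
        (Set.Ico (a i' j') (a i' j' + c * (t i'.succ - t i'.castSucc)))) ∧
    (∀ y ∈ unitI, ∃ (i : Fin k) (j : ℕ), j < n i ∧
      y ∈ Set.Ico (a i j) (a i j + c * (t i.succ - t i.castSucc))) ∧
    (∀ i : Fin k, ∀ j : ℕ, j + 1 < n i → ∀ x ∈ Set.Ico (t i.castSucc) (t i.succ),
      T (a i j + c * (x - t i.castSucc)) = a i (j + 1) + c * (x - t i.castSucc)) ∧
    (∀ i : Fin k, ∀ x ∈ Set.Ico (t i.castSucc) (t i.succ), ∀ i' : Fin k,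
      S x ∈ Set.Ico (t i'.castSucc) (t i'.succ) →
      T (a i (n i - 1) + c * (x - t i.castSucc)) = a i' 0 + c * (S x - t i'.castSucc))

/-- The data of the first return map of `T` to `J = [a,b)`: a partition
`a = s_0 < s_1 < ⋯ < s_k = b` of `J`, return times `mt_i ≥ 1` and translation
constants `c_i` such that for `x` in the `i`-th piece the iterates `T^j x`, `0 < j < mt_i`,
avoid `J`, while `T^{mt_i} x = x + c_i ∈ J`.  Thus the first return map `T_J` is the
`k`-IET `x ↦ x + c_i` on the `i`-th piece. -/
def IsFirstReturnSystem (T : ℝ → ℝ) (a b : ℝ) {k : ℕ} (s : Fin (k + 1) → ℝ)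
    (mt : Fin k → ℕ) (c : Fin k → ℝ) : Prop :=
  StrictMono s ∧ s 0 = a ∧ s (Fin.last k) = b ∧
  ∀ i : Fin k, 0 < mt i ∧ ∀ x ∈ Set.Ico (s i.castSucc) (s i.succ),
    (∀ j : ℕ, 0 < j → j < mt i → T^[j] x ∉ Set.Ico a b) ∧
    T^[mt i] x ∈ Set.Ico a b ∧ T^[mt i] x = x + c i

/-- A finite sequence `x_0, …, x_k` is an `S`-chain if `x_0` and `x_k` lie in
`D(S) ∪ {0}` and `S x_i = x_{i+1}`. -/
def IsSChainSeq (S : ℝ → ℝ) {k : ℕ} (x : Fin (k + 1) → ℝ) : Prop :=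
  x 0 ∈ insert (0 : ℝ) (DiscSet S) ∧ x (Fin.last k) ∈ insert (0 : ℝ) (DiscSet S) ∧
  ∀ i : Fin k, S (x i.castSucc) = x i.succ

/-- A set `C ⊆ ℝ` is (the underlying set of) an `S`-chain. -/
def IsSChain (S : ℝ → ℝ) (C : Set ℝ) : Prop :=
  ∃ (k : ℕ) (x : Fin (k + 1) → ℝ), IsSChainSeq S x ∧ C = Set.range x

/-- A maximal `S`-chain: an `S`-chain which is not a proper subset of another `S`-chain. -/
def IsMaximalSChain (S : ℝ → ℝ) (C : Set ℝ) : Prop :=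
  IsSChain S C ∧ ∀ C', IsSChain S C' → C ⊆ C' → C = C'

/-- The open simplex `Δ_m ⊆ ℝ^m`. -/
def simplexSet (m : ℕ) : Set (Fin m → ℝ) := {lam | (∀ i, 0 < lam i) ∧ ∑ i, lam i = 1}

/-- The affine chart identifying (a superset of) `Δ_m` with a subset of `ℝ^{m-1}`:
`λ_i = x_i` for `i < m-1` and `λ_{m-1} = 1 - ∑ x_j`.  Lebesgue measure on `Δ_m`
is the `(m-1)`-dimensional Lebesgue measure carried through this chart. -/
def chartMap (m : ℕ) (x : Fin (m - 1) → ℝ) : Fin m → ℝ := fun i =>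
  if h : (i : ℕ) < m - 1 then x ⟨(i : ℕ), h⟩ else 1 - ∑ j, x j

/-- The permutation `(321) ∈ S_3`, sending `1 ↦ 3`, `2 ↦ 2`, `3 ↦ 1`. -/
def perm321 : Equiv.Perm (Fin 3) :=
  ⟨fun i => i.rev, fun i => i.rev, fun i => Fin.rev_rev i, fun i => Fin.rev_rev i⟩

end


lemma beta_zero (lam : Fin 3 → ℝ) : betaPt lam 0 = 0 := by
  simp [betaPt]

lemma beta_one (lam : Fin 3 → ℝ) : betaPt lam 1 = lam 0 := by
  simp [betaPt, Finset.sum_filter, Fin.sum_univ_three]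

lemma beta_two (lam : Fin 3 → ℝ) : betaPt lam 2 = lam 0 + lam 1 := by
  simp [betaPt, Finset.sum_filter, Fin.sum_univ_three]

lemma iet_cases (lam : Fin 3 → ℝ) (x : ℝ) :
    ((0 ≤ x ∧ x < lam 0) ∧ ietMap perm321 lam x = x + (lam 1 + lam 2)) ∨
    ((lam 0 ≤ x ∧ x < lam 0 + lam 1) ∧ ietMap perm321 lam x = x - lam 0 + lam 2) ∨
    ((lam 0 + lam 1 ≤ x ∧ x < lam 0 + lam 1 + lam 2) ∧
      ietMap perm321 lam x = x - (lam 0 + lam 1)) ∨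
    ((¬ ∃ j : Fin 3, x ∈ Set.Ico (betaPt lam (j : ℕ)) (betaPt lam (j : ℕ) + lam j)) ∧
      ietMap perm321 lam x = x) := by
  by_cases h : ∃ j : Fin 3, x ∈ Set.Ico (betaPt lam (j : ℕ)) (betaPt lam (j : ℕ) + lam j)
  · have hT : ietMap perm321 lam x = x - betaPt lam (h.choose : ℕ) +
        ∑ i ∈ Finset.univ.filter (fun i : Fin 3 => perm321 i < perm321 h.choose), lam i := by
      simp only [ietMap, dif_pos h]
    have hx := h.choose_spec
    generalize h.choose = j at hT hx
    have r0 : perm321 0 = 2 := rfl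
    have r1 : perm321 1 = 1 := rfl
    have r2 : perm321 2 = 0 := rfl
    fin_cases j
    · left
      simp [beta_zero, Finset.sum_filter, Fin.sum_univ_three, r0, r1, r2] at hT hx
      exact ⟨hx, hT⟩
    · right; left
      simp [beta_one, Finset.sum_filter, Fin.sum_univ_three, r0, r1, r2] at hT hx
      exact ⟨hx, hT⟩
    · right; right; left
      simp [beta_two, Finset.sum_filter, Fin.sum_univ_three, r0, r1, r2] at hT hx
      exact ⟨hx, hT⟩
  · right; right; right
    exact ⟨h, by simp only [ietMap, dif_neg h]⟩

lemma iet_cases_mem (lam : Fin 3 → ℝ) (hs : lam 0 + lam 1 + lam 2 = 1) (x : ℝ)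
    (hx : x ∈ unitI) :
    ((0 ≤ x ∧ x < lam 0) ∧ ietMap perm321 lam x = x + (lam 1 + lam 2)) ∨
    ((lam 0 ≤ x ∧ x < lam 0 + lam 1) ∧ ietMap perm321 lam x = x - lam 0 + lam 2) ∨
    ((lam 0 + lam 1 ≤ x ∧ x < lam 0 + lam 1 + lam 2) ∧
      ietMap perm321 lam x = x - (lam 0 + lam 1)) := by
  rcases iet_cases lam x with h | h | h | ⟨h, -⟩
  · exact Or.inl h
  · exact Or.inr (Or.inl h)
  · exact Or.inr (Or.inr h)
  · exfalso
    apply h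
    obtain ⟨hx0, hx1⟩ := hx
    by_cases c1 : x < lam 0
    · refine ⟨0, ?_⟩
      simp [beta_zero, hx0, c1]
    by_cases c2 : x < lam 0 + lam 1
    · refine ⟨1, ?_⟩
      simp [beta_one, c2, not_lt.mp c1]
    · refine ⟨2, ?_⟩
      simp [beta_two, not_lt.mp c2]
      linarith

/-- All displacements lie in the group generated by `1 - λ₁` and `1 - λ₃`. -/
lemma iterate_diff (lam : Fin 3 → ℝ) (hs : lam 0 + lam 1 + lam 2 = 1) (n : ℕ) (x : ℝ) :
    ∃ i j : ℤ, (ietMap perm321 lam)^[n] x = x + i * (1 - lam 0) + j * (1 - lam 2) := by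
  have e : lam 1 = 1 - lam 0 - lam 2 := by linarith
  induction n generalizing x with
  | zero => exact ⟨0, 0, by simp⟩
  | succ n ih =>
    obtain ⟨i, j, h⟩ := ih (ietMap perm321 lam x)
    rw [Function.iterate_succ_apply, h]
    rcases iet_cases lam x with ⟨-, h⟩ | ⟨-, h⟩ | ⟨-, h⟩ | ⟨-, h⟩
    · exact ⟨i + 1, j, by rw [h, e]; push_cast; ring⟩
    · exact ⟨i + 1, j - 1, by rw [h]; push_cast; ring⟩
    · exact ⟨i, j - 1, by rw [h, e]; push_cast; ring⟩
    · exact ⟨i, j, by rw [h]⟩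

lemma orbit_diff (lam : Fin 3 → ℝ) (_hpos : ∀ i, 0 < lam i) (hs : lam 0 + lam 1 + lam 2 = 1)
    {x z : ℝ} (hz : z ∈ orbitZ (ietMap perm321 lam) x) :
    ∃ i j : ℤ, z = x + i * (1 - lam 0) + j * (1 - lam 2) := by
  obtain ⟨n, h | h⟩ := hz
  · obtain ⟨i, j, hij⟩ := iterate_diff lam hs n x
    exact ⟨i, j, by rw [← h, hij]⟩
  · obtain ⟨i, j, hij⟩ := iterate_diff lam hs n z
    refine ⟨-i, -j, ?_⟩
    rw [h] at hij
    push_cast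
    linarith

/-- `T` is induced by the rotation by `1 - λ₁` on the circle of length `1 + λ₂`: points of
`[0,1)` in the same rotation orbit are in the same `T`-orbit. -/
lemma reach (lam : Fin 3 → ℝ) (hpos : ∀ i, 0 < lam i) (hs : lam 0 + lam 1 + lam 2 = 1)
    (p : ℕ) : ∀ (x y : ℝ) (q : ℤ), x ∈ unitI → y ∈ unitI →
      y = x + p * (1 - lam 0) - q * (1 + lam 1) →
      ∃ k : ℕ, (ietMap perm321 lam)^[k] x = y := by
  have h0 := hpos 0
  have h1 := hpos 1
  have h2 := hpos 2
  induction p using Nat.strong_induction_on with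
  | _ p ih =>
    intro x y q hx hy h
    obtain ⟨hx0, hx1⟩ := hx
    obtain ⟨hy0, hy1⟩ := hy
    have small : ∀ q : ℤ, q < 1 → -1 < q → q = 0 := by intros; omega
    rcases Nat.eq_zero_or_pos p with rfl | hp
    · refine ⟨0, ?_⟩
      have a1 : q < 1 := by
        by_contra hc
        have : (1 : ℝ) ≤ q := by exact_mod_cast not_lt.mp hc
        push_cast at h
        nlinarith
      have a2 : -1 < q := by
        by_contra hc
        have : (q : ℝ) ≤ -1 := by exact_mod_cast not_lt.mp hc
        push_cast at h
        nlinarith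
      have := small q a1 a2
      subst this
      simp at h
      simp [h]
    · obtain ⟨p', rfl⟩ := Nat.exists_eq_succ_of_ne_zero hp.ne'
      push_cast at h
      rcases iet_cases_mem lam hs x ⟨hx0, hx1⟩ with ⟨⟨c1, c2⟩, hT⟩ | ⟨⟨c1, c2⟩, hT⟩ | ⟨⟨c1, c2⟩, hT⟩
      · obtain ⟨k, hk⟩ := ih p' (by omega) (ietMap perm321 lam x) y q
          ⟨by rw [hT]; linarith, by rw [hT]; linarith⟩ ⟨hy0, hy1⟩
          (by rw [hT]; linear_combination h - hs)
        exact ⟨k + 1, by rw [Function.iterate_succ_apply, hk]⟩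
      · rcases Nat.eq_zero_or_pos p' with rfl | hp'
        · exfalso
          push_cast at h
          rcases le_or_gt q 0 with hq | hq
          · have : (q : ℝ) ≤ 0 := by exact_mod_cast hq
            nlinarith
          · have : (1 : ℝ) ≤ q := by exact_mod_cast hq
            nlinarith
        · obtain ⟨p'', rfl⟩ := Nat.exists_eq_succ_of_ne_zero hp'.ne'
          push_cast at h
          obtain ⟨k, hk⟩ := ih p'' (by omega) (ietMap perm321 lam x) y (q - 1)
            ⟨by rw [hT]; linarith, by rw [hT]; linarith⟩ ⟨hy0, hy1⟩
            (by rw [hT]; push_cast; linear_combination h - hs)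
          exact ⟨k + 1, by rw [Function.iterate_succ_apply, hk]⟩
      · obtain ⟨k, hk⟩ := ih p' (by omega) (ietMap perm321 lam x) y (q - 1)
          ⟨by rw [hT]; linarith, by rw [hT]; linarith⟩ ⟨hy0, hy1⟩
          (by rw [hT]; push_cast; linear_combination h)
        exact ⟨k + 1, by rw [Function.iterate_succ_apply, hk]⟩

theorem stmt19 (lam : Fin 3 → ℝ) (hpos : ∀ i, 0 < lam i) (hsum : ∑ i, lam i = 1)
    (hmin : IsMinimal (ietMap perm321 lam)) :
    SatisfiesIDOC lam (ietMap perm321 lam) ↔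
      ∀ n m : ℤ, (n : ℝ) * (lam 0 - lam 2) ≠ lam 0 + (m : ℝ) * (1 - lam 2) := by
  have hs : lam 0 + lam 1 + lam 2 = 1 := by rw [← hsum, Fin.sum_univ_three]
  have h0 := hpos 0
  have h1 := hpos 1
  have h2 := hpos 2
  have hb1 : betaPt lam 1 = lam 0 := beta_one lam
  have hb2 : betaPt lam 2 = lam 0 + lam 1 := beta_two lam
  constructor
  · rintro ⟨-, hd⟩ n m hnm
    have hdis := hd 1 2 le_rfl (by norm_num) (by norm_num) le_rfl (by norm_num)
    rw [hb1, hb2] at hdis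
    have hx : lam 0 + lam 1 ∈ unitI := ⟨by linarith, by linarith⟩
    have hy : lam 0 ∈ unitI := ⟨by linarith, by linarith⟩
    have hmem : lam 0 ∈ orbitZ (ietMap perm321 lam) (lam 0 + lam 1) := by
      rcases le_total 0 (m + 1 - 2 * n) with hp | hp
      · obtain ⟨p, hp⟩ := Int.eq_ofNat_of_zero_le hp
        obtain ⟨k, hk⟩ := reach lam hpos hs p (lam 0 + lam 1) (lam 0) (m + 1 - n) hx hy (by
          have hp' : (p : ℝ) = (m : ℝ) + 1 - 2 * n := by
            exact_mod_cast hp.symm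
          have e : lam 1 = 1 - lam 0 - lam 2 := by linarith
          rw [hp', e]; push_cast; linear_combination -hnm)
        exact ⟨k, Or.inl hk⟩
      · obtain ⟨p, hp⟩ := Int.eq_ofNat_of_zero_le (neg_nonneg.mpr hp)
        obtain ⟨k, hk⟩ := reach lam hpos hs p (lam 0) (lam 0 + lam 1) (-(m + 1 - n)) hy hx (by
          have hp' : (p : ℝ) = -((m : ℝ) + 1 - 2 * n) := by
            exact_mod_cast hp.symm
          have e : lam 1 = 1 - lam 0 - lam 2 := by linarith
          rw [hp', e]; push_cast; linear_combination hnm)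
        exact ⟨k, Or.inr hk⟩
    have : lam 0 ∈ (∅ : Set ℝ) := by
      rw [← hdis]; exact ⟨⟨0, Or.inl rfl⟩, hmem⟩
    exact this
  · intro h
    refine ⟨?_, ?_⟩
    · intro j hj1 hj2
      have hx : betaPt lam j ∈ unitI := by
        have : j = 1 ∨ j = 2 := by omega
        rcases this with rfl | rfl
        · rw [hb1]; exact ⟨by linarith, by linarith⟩
        · rw [hb2]; exact ⟨by linarith, by linarith⟩
      intro hfin
      have hsub := hmin _ hx
      rw [hfin.isClosed.closure_eq] at hsub
      exact (Set.Ico_infinite (zero_lt_one' ℝ)) (hfin.subset hsub)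
    · have key : ∀ z, z ∈ orbitZ (ietMap perm321 lam) (lam 0) →
          z ∈ orbitZ (ietMap perm321 lam) (lam 0 + lam 1) → False := by
        intro z hz1 hz2
        obtain ⟨i, j, hij⟩ := orbit_diff lam hpos hs hz1
        obtain ⟨i', j', hij'⟩ := orbit_diff lam hpos hs hz2
        have e : lam 1 = 1 - lam 0 - lam 2 := by linarith
        rw [e] at hij'
        refine h (i - i') (-(i' - i + j' - j + 1)) ?_
        push_cast
        linear_combination hij - hij'
      intro j j' hj1 hj2 hj1' hj2' hne
      ext z
      simp only [Set.mem_inter_iff, Set.mem_empty_iff_false, iff_false]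
      rintro ⟨hz1, hz2⟩
      have : (j = 1 ∧ j' = 2) ∨ (j = 2 ∧ j' = 1) := by omega
      rcases this with ⟨rfl, rfl⟩ | ⟨rfl, rfl⟩
      · rw [hb1] at hz1; rw [hb2] at hz2; exact key z hz1 hz2
      · rw [hb1] at hz2; rw [hb2] at hz1; exact key z hz2 hz1

end IETRoots
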